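/- (Kaniel–Paige–Saad bound, exponential form.) Under the hypotheses of the Kaniel–Paige–Saad bound (K(A,v,n) has dimension n; ⟨z_j, v⟩ ≠ 0; λ_{j+1} > λ_N; θ_i > λ_j for all i < j) and assuming additionally λ_j > λ_{j+1}, set μ_j = √((λ_j − λ_{j+1})/(λ_{j+1} − λ_N)). Then γ_j(λ_j) = 1 + 2μ_j² and 0 ≤ λ_j − θ_j ≤ 4·(λ_j − λ_N)·(K_j·tan∠_j)²·(1 + 2μ_j² + 2μ_j·√(1 + μ_j²))^{−2(n−j)}. -/

import Mathlib

open Matrix Polynomial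

/-- The Krylov subspace `K(A,v,n) = span(v, Av, …, A^{n-1}v)`. -/
noncomputable def Krylov {N : ℕ} (A : Matrix (Fin N) (Fin N) ℂ) (v : Fin N → ℂ) (n : ℕ) :
    Submodule ℂ (Fin N → ℂ) :=
  Submodule.span ℂ {w | ∃ k < n, w = (A ^ k).mulVec v}

theorem sum_dotProduct_smul_of_orthonormal {ι : Type*} [Fintype ι] [DecidableEq ι]
    {e : ι → ι → ℂ} (he : ∀ i k, star (e i) ⬝ᵥ e k = if i = k then 1 else 0) (x : ι → ℂ) :
    ∑ k, (star (e k) ⬝ᵥ x) • e k = x := by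
  set Z : Matrix ι ι ℂ := fun a b => e b a
  have h1 : Zᴴ * Z = 1 := by
    ext i k
    rw [Matrix.one_apply, ← he]
    rfl
  have h2 : Z * Zᴴ = 1 := mul_eq_one_comm.mp h1
  calc ∑ k, (star (e k) ⬝ᵥ x) • e k = Z *ᵥ (Zᴴ *ᵥ x) := by
        ext a
        simp only [Finset.sum_apply, Pi.smul_apply, smul_eq_mul]
        exact Finset.sum_congr rfl fun k _ => mul_comm _ _
    _ = x := by rw [mulVec_mulVec, h2, one_mulVec]

theorem star_dotProduct_mulVec_of_eigenbasis {ι : Type*} [Fintype ι] [DecidableEq ι]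
    {e : ι → ι → ℂ} (he : ∀ i k, star (e i) ⬝ᵥ e k = if i = k then 1 else 0)
    {B : Matrix ι ι ℂ} {l : ι → ℝ} (hB : ∀ i, B *ᵥ e i = (l i : ℂ) • e i) (x : ι → ℂ) :
    star x ⬝ᵥ (B *ᵥ x) = ((∑ k, l k * ‖star (e k) ⬝ᵥ x‖ ^ 2 : ℝ) : ℂ) := by
  conv_lhs => rw [← sum_dotProduct_smul_of_orthonormal he x, mulVec_sum, dotProduct_sum]
  rw [Complex.ofReal_sum]
  refine Finset.sum_congr rfl fun k _ => ?_
  rw [sum_dotProduct_smul_of_orthonormal he x, mulVec_smul, hB, dotProduct_smul, dotProduct_smul,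
    star_dotProduct x]
  push_cast
  rw [← Complex.mul_conj', smul_eq_mul, smul_eq_mul, starRingEnd_apply]
  ring

theorem star_dotProduct_self_of_orthonormal {ι : Type*} [Fintype ι] [DecidableEq ι]
    {e : ι → ι → ℂ} (he : ∀ i k, star (e i) ⬝ᵥ e k = if i = k then 1 else 0) (x : ι → ℂ) :
    star x ⬝ᵥ x = ((∑ k, ‖star (e k) ⬝ᵥ x‖ ^ 2 : ℝ) : ℂ) := by
  simpa using star_dotProduct_mulVec_of_eigenbasis he (B := 1) (l := fun _ => 1) (by simp) x

theorem star_dotProduct_mulVec_of_eigenvector {ι : Type*} [Fintype ι]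
    {B : Matrix ι ι ℂ} (hB : B.IsHermitian) {e : ι → ℂ} {l : ℝ} (he : B *ᵥ e = (l : ℂ) • e)
    (x : ι → ℂ) : star e ⬝ᵥ (B *ᵥ x) = l * (star e ⬝ᵥ x) := by
  have h : star e ᵥ* B = (l : ℂ) • star e := by
    have h := congrArg star he
    rw [star_mulVec, hB.eq] at h
    simpa using h
  rw [dotProduct_mulVec, h, smul_dotProduct, smul_eq_mul]

theorem star_dotProduct_aeval_mulVec {ι : Type*} [Fintype ι] [DecidableEq ι]
    {B : Matrix ι ι ℂ} (hB : B.IsHermitian) {e : ι → ℂ} {l : ℝ} (he : B *ᵥ e = (l : ℂ) • e)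
    (p : ℝ[X]) (x : ι → ℂ) :
    star e ⬝ᵥ (aeval B p *ᵥ x) = (p.eval l : ℝ) * (star e ⬝ᵥ x) := by
  induction p using Polynomial.induction_on' generalizing x with
  | add p q hp hq =>
    rw [map_add, add_mulVec, dotProduct_add, hp, hq, eval_add]
    push_cast
    ring
  | monomial k a =>
    have hpow : ∀ x : ι → ℂ, star e ⬝ᵥ ((B ^ k) *ᵥ x) = (l : ℂ) ^ k * (star e ⬝ᵥ x) := by
      induction k with
      | zero => simp
      | succ k ih =>
        intro x
        rw [pow_succ, ← mulVec_mulVec, ih, star_dotProduct_mulVec_of_eigenvector hB he]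
        ring
    rw [aeval_monomial, ← Algebra.smul_def, smul_mulVec, dotProduct_smul, hpow, eval_monomial,
      Complex.real_smul]
    push_cast
    ring

theorem aeval_mulVec_mem_Krylov {N n : ℕ} (A : Matrix (Fin N) (Fin N) ℂ) (v : Fin N → ℂ)
    {p : ℝ[X]} (hp : p.natDegree < n) : aeval A p *ᵥ v ∈ Krylov A v n := by
  rw [aeval_eq_sum_range' hp, sum_mulVec]
  refine Submodule.sum_mem _ fun k hk => ?_
  rw [smul_mulVec]
  exact Submodule.smul_of_tower_mem _ _
    (Submodule.subset_span ⟨k, Finset.mem_range.mp hk, rfl⟩)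

theorem half_pow_le_eval_T (μ : ℝ) (m : ℕ) :
    (1 + 2 * μ ^ 2 + 2 * μ * √(1 + μ ^ 2)) ^ m / 2 ≤ (Chebyshev.T ℝ m).eval (1 + 2 * μ ^ 2) := by
  set t := Real.arsinh μ
  have hs : Real.sinh t = μ := Real.sinh_arsinh μ
  have hc : Real.cosh t = √(1 + μ ^ 2) := Real.cosh_arsinh μ
  have h2 : 1 + 2 * μ ^ 2 = Real.cosh (2 * t) := by
    rw [Real.cosh_two_mul, hs, Real.cosh_sq, hs]; ring
  have h3 : 2 * μ * √(1 + μ ^ 2) = Real.sinh (2 * t) := by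
    rw [Real.sinh_two_mul, hs, hc]
  rw [h3, h2, Real.cosh_add_sinh, Chebyshev.T_real_cosh, Real.cosh_eq, ← Real.exp_nat_mul]
  push_cast
  have := Real.exp_pos (-(m * (2 * t)))
  linarith

theorem exists_ne_zero_forall_dotProduct_eq_zero {n : ℕ} (j : Fin n) (r : Fin n → Fin n → ℂ) :
    ∃ x : Fin n → ℂ, x ≠ 0 ∧ ∀ i ≠ j, r i ⬝ᵥ x = 0 := by
  classical
  obtain ⟨x, hx, h⟩ := exists_mulVec_eq_zero_iff.mpr
    (det_eq_zero_of_row_eq_zero (A := fun i => if i = j then 0 else r i) j (by simp))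
  refine ⟨x, hx, fun i hi => ?_⟩
  have := congrFun h i
  simpa [mulVec, hi] using this

theorem sum_mul_le_mul_sum_of_antitone {ι : Type*} [Fintype ι] [LinearOrder ι] {l c : ι → ℝ} (hl : Antitone l)
    (hc : ∀ k, 0 ≤ c k) (j : ι) (h : ∀ k < j, c k = 0) : ∑ k, l k * c k ≤ l j * ∑ k, c k := by
  rw [Finset.mul_sum]
  refine Finset.sum_le_sum fun k _ => ?_
  rcases lt_or_ge k j with hk | hk
  · simp [h k hk]
  · exact mul_le_mul_of_nonneg_right (hl hk) (hc k)

theorem mul_sum_le_sum_mul_of_antitone {ι : Type*} [Fintype ι] [LinearOrder ι] {l c : ι → ℝ} (hl : Antitone l)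
    (hc : ∀ k, 0 ≤ c k) (j : ι) (h : ∀ k, j < k → c k = 0) : l j * ∑ k, c k ≤ ∑ k, l k * c k := by
  rw [Finset.mul_sum]
  refine Finset.sum_le_sum fun k _ => ?_
  rcases lt_or_ge j k with hk | hk
  · simp [h k hk]
  · exact mul_le_mul_of_nonneg_right (hl hk) (hc k)

section RayleighRitz

variable {N n : ℕ} {A : Matrix (Fin N) (Fin N) ℂ} {lam : Fin N → ℝ} {z : Fin N → Fin N → ℂ}
  {Q : Matrix (Fin N) (Fin n) ℂ} {θ : Fin n → ℝ} {s : Fin n → Fin n → ℂ}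

theorem star_mulVec_dotProduct_mulVec (hQ : Qᴴ * Q = 1) (x y : Fin n → ℂ) :
    star (Q *ᵥ x) ⬝ᵥ (Q *ᵥ y) = star x ⬝ᵥ y := by
  rw [star_mulVec, dotProduct_mulVec, vecMul_vecMul, hQ, vecMul_one]

theorem star_mulVec_dotProduct_mulVec_mulVec (x y : Fin n → ℂ) :
    star (Q *ᵥ x) ⬝ᵥ (A *ᵥ (Q *ᵥ y)) = star x ⬝ᵥ ((Qᴴ * A * Q) *ᵥ y) := by
  rw [star_mulVec, ← mulVec_mulVec, ← mulVec_mulVec, dotProduct_mulVec (star x), dotProduct_mulVec]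

theorem sum_eq_sum_ritz
    (hz : ∀ i k, star (z i) ⬝ᵥ z k = if i = k then 1 else 0) (hQ : Qᴴ * Q = 1)
    (hs : ∀ i k, star (s i) ⬝ᵥ s k = if i = k then 1 else 0) (x : Fin n → ℂ) :
    ∑ k, ‖star (z k) ⬝ᵥ (Q *ᵥ x)‖ ^ 2 = ∑ k, ‖star (s k) ⬝ᵥ x‖ ^ 2 := by
  have h := star_mulVec_dotProduct_mulVec hQ x x
  rw [star_dotProduct_self_of_orthonormal hz, star_dotProduct_self_of_orthonormal hs] at h
  exact_mod_cast h

theorem sum_eigenvalue_eq_sum_ritz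
    (hz : ∀ i k, star (z i) ⬝ᵥ z k = if i = k then 1 else 0)
    (hAz : ∀ i, A *ᵥ z i = (lam i : ℂ) • z i)
    (hs : ∀ i k, star (s i) ⬝ᵥ s k = if i = k then 1 else 0)
    (hθs : ∀ i, (Qᴴ * A * Q) *ᵥ s i = (θ i : ℂ) • s i) (x : Fin n → ℂ) :
    ∑ k, lam k * ‖star (z k) ⬝ᵥ (Q *ᵥ x)‖ ^ 2 = ∑ k, θ k * ‖star (s k) ⬝ᵥ x‖ ^ 2 := by
  have h := star_mulVec_dotProduct_mulVec_mulVec (Q := Q) (A := A) x x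
  rw [star_dotProduct_mulVec_of_eigenbasis hz hAz,
    star_dotProduct_mulVec_of_eigenbasis hs hθs] at h
  exact_mod_cast h

/-- Half of Cauchy interlacing: a Ritz value is at most the eigenvalue of the same rank. -/
theorem ritz_le_eigenvalue (hlam : Antitone lam)
    (hz : ∀ i k, star (z i) ⬝ᵥ z k = if i = k then 1 else 0)
    (hAz : ∀ i, A *ᵥ z i = (lam i : ℂ) • z i) (hnN : n ≤ N) (hQ : Qᴴ * Q = 1) (hθ : Antitone θ)
    (hs : ∀ i k, star (s i) ⬝ᵥ s k = if i = k then 1 else 0)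
    (hθs : ∀ i, (Qᴴ * A * Q) *ᵥ s i = (θ i : ℂ) • s i) (j : Fin n) :
    θ j ≤ lam (Fin.castLE hnN j) := by
  obtain ⟨x, hx, h⟩ := exists_ne_zero_forall_dotProduct_eq_zero j fun i =>
    if i < j then star (z (Fin.castLE hnN i)) ᵥ* Q else star (s i)
  have h1 := sum_mul_le_mul_sum_of_antitone hlam (c := fun k => ‖star (z k) ⬝ᵥ (Q *ᵥ x)‖ ^ 2)
    (fun k => by positivity) (Fin.castLE hnN j) fun k hk => by
      have hkj : (k : ℕ) < j := hk
      have := h ⟨k, hkj.trans j.2⟩ (by simp [Fin.ext_iff]; omega)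
      rw [if_pos (by exact hkj), ← dotProduct_mulVec] at this
      change star (z k) ⬝ᵥ _ = 0 at this
      simp [this]
  have h2 := mul_sum_le_sum_mul_of_antitone hθ (c := fun k => ‖star (s k) ⬝ᵥ x‖ ^ 2)
    (fun k => by positivity) j fun k hk => by
      have := h k hk.ne'
      rw [if_neg hk.not_gt] at this
      simp [this]
  rw [sum_eq_sum_ritz hz hQ hs, sum_eigenvalue_eq_sum_ritz hz hAz hs hθs] at h1
  refine le_of_mul_le_mul_right (h2.trans h1) (lt_of_le_of_ne (by positivity) fun h0 => hx ?_)
  open scoped ComplexOrder in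
  rw [← dotProduct_star_self_eq_zero, star_dotProduct_self_of_orthonormal hs, ← h0,
    Complex.ofReal_zero]

theorem star_ritz_dotProduct_sub_mulVec (hA : A.IsHermitian) (hQ : Qᴴ * Q = 1)
    (hθs : ∀ i, (Qᴴ * A * Q) *ᵥ s i = (θ i : ℂ) • s i) (i : Fin n) (t : Fin n → ℂ) :
    star (Q *ᵥ s i) ⬝ᵥ ((A - algebraMap ℝ _ (θ i)) *ᵥ (Q *ᵥ t)) = 0 := by
  have hH : (Qᴴ * A * Q).IsHermitian := isHermitian_conjTranspose_mul_mul Q hA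
  rw [sub_mulVec, dotProduct_sub, star_mulVec_dotProduct_mulVec_mulVec,
    star_dotProduct_mulVec_of_eigenvector hH (hθs i), Algebra.algebraMap_eq_smul_one, smul_mulVec,
    one_mulVec, dotProduct_smul, star_mulVec_dotProduct_mulVec hQ, Complex.real_smul, sub_self]

/-- Multiplying a Krylov polynomial by `X - θ_i` makes it orthogonal to the `i`-th Ritz vector. -/
theorem star_ritz_dotProduct_aeval_mulVec (hA : A.IsHermitian) (hQ : Qᴴ * Q = 1) {v : Fin N → ℂ}
    (hQX : LinearMap.range Q.mulVecLin = Krylov A v n)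
    (hθs : ∀ i, (Qᴴ * A * Q) *ᵥ s i = (θ i : ℂ) • s i) (i : Fin n) {p q : ℝ[X]}
    (hp : p.natDegree < n) (hpq : p = (X - C (θ i)) * q) :
    star (Q *ᵥ s i) ⬝ᵥ (aeval A p *ᵥ v) = 0 := by
  rcases eq_or_ne q 0 with rfl | hq
  · simp [hpq]
  have hq' : q.natDegree < n := by
    rw [hpq, natDegree_mul (X_sub_C_ne_zero _) hq] at hp
    omega
  have hmem := aeval_mulVec_mem_Krylov A v hq'
  rw [← hQX] at hmem
  obtain ⟨t, ht⟩ := hmem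
  rw [mulVecLin_apply] at ht
  rw [hpq, map_mul, ← mulVec_mulVec, ← ht, map_sub, aeval_X, aeval_C]
  exact star_ritz_dotProduct_sub_mulVec hA hQ hθs i t

/-- The Rayleigh quotient of a Krylov vector `p(A)v` such that `p` vanishes at the first `j`
Ritz values is at most the `j`-th Ritz value. -/
theorem sum_eigenvalue_mul_eval_le (hA : A.IsHermitian)
    (hz : ∀ i k, star (z i) ⬝ᵥ z k = if i = k then 1 else 0)
    (hAz : ∀ i, A *ᵥ z i = (lam i : ℂ) • z i) {v : Fin N → ℂ} (hQ : Qᴴ * Q = 1)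
    (hQX : LinearMap.range Q.mulVecLin = Krylov A v n) (hθ : Antitone θ)
    (hs : ∀ i k, star (s i) ⬝ᵥ s k = if i = k then 1 else 0)
    (hθs : ∀ i, (Qᴴ * A * Q) *ᵥ s i = (θ i : ℂ) • s i) (j : Fin n) {p : ℝ[X]}
    (hp : p.natDegree < n) (hdvd : ∀ i < j, X - C (θ i) ∣ p) :
    ∑ k, lam k * ((p.eval (lam k)) ^ 2 * ‖star (z k) ⬝ᵥ v‖ ^ 2) ≤
      θ j * ∑ k, (p.eval (lam k)) ^ 2 * ‖star (z k) ⬝ᵥ v‖ ^ 2 := by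
  have hmem := aeval_mulVec_mem_Krylov A v hp
  rw [← hQX] at hmem
  obtain ⟨t, ht⟩ := hmem
  rw [mulVecLin_apply] at ht
  have hcoef (k : Fin N) : (p.eval (lam k)) ^ 2 * ‖star (z k) ⬝ᵥ v‖ ^ 2 =
      ‖star (z k) ⬝ᵥ (Q *ᵥ t)‖ ^ 2 := by
    rw [ht, star_dotProduct_aeval_mulVec hA (hAz k), norm_mul, mul_pow, Complex.norm_real,
      Real.norm_eq_abs, sq_abs]
  simp only [hcoef]
  rw [sum_eigenvalue_eq_sum_ritz hz hAz hs hθs, sum_eq_sum_ritz hz hQ hs]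
  refine sum_mul_le_mul_sum_of_antitone hθ (fun k => by positivity) j fun i hi => ?_
  obtain ⟨q, hq⟩ := hdvd i hi
  rw [← star_mulVec_dotProduct_mulVec hQ, ht,
    star_ritz_dotProduct_aeval_mulVec hA hQ hQX hθs i hp hq]
  simp

end RayleighRitz

theorem gap_mul_le_of_sum_le {N : ℕ} {l w a : Fin N → ℝ} {j : Fin N} {θ b m : ℝ}
    (hl : Antitone l) (hw : ∀ k, 0 ≤ w k) (ha : ∀ k, 0 ≤ a k) (hθ : θ ≤ l j)
    (hm : ∀ k, m ≤ l k) (hwb : ∀ k, j < k → w k ≤ b)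
    (h : ∑ k, l k * (w k * a k) ≤ θ * ∑ k, w k * a k) :
    (l j - θ) * (w j * a j) ≤
      (l j - m) * (b * ∑ k ∈ Finset.univ.filter fun k : Fin N => (j : ℕ) < (k : ℕ), a k) := by
  have h1 : (l j - θ) * (w j * a j) ≤ (l j - θ) * ∑ k, w k * a k :=
    mul_le_mul_of_nonneg_left
      (Finset.single_le_sum (f := fun k => w k * a k) (fun k _ => mul_nonneg (hw k) (ha k))
        (Finset.mem_univ j)) (by linarith)
  have h2 : (l j - θ) * ∑ k, w k * a k ≤ ∑ k, (l j - l k) * (w k * a k) := by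
    simp only [sub_mul, Finset.sum_sub_distrib, ← Finset.mul_sum]
    linarith
  refine h1.trans (h2.trans ?_)
  rw [Finset.mul_sum, Finset.mul_sum, Finset.sum_filter]
  refine Finset.sum_le_sum fun k _ => ?_
  split_ifs with hk
  · exact mul_le_mul (by linarith [hm k]) (mul_le_mul_of_nonneg_right (hwb k hk) (ha k))
      (mul_nonneg (hw k) (ha k)) (by linarith [hm j])
  · exact mul_nonpos_of_nonpos_of_nonneg (sub_nonpos.mpr (hl (not_lt.mp hk)))
      (mul_nonneg (hw k) (ha k))

/-- The polynomial `∏_{i<j} (X - θ_i) · T_{n-1-j}(γ_j)`, for `γ_j` the affine map sending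
`[c, d]` to `[-1, 1]`. -/
noncomputable def kanielPoly {n : ℕ} (θ : Fin n → ℝ) (j : Fin n) (c d : ℝ) : ℝ[X] :=
  (∏ i ∈ Finset.univ.filter fun i : Fin n => (i : ℕ) < (j : ℕ), (X - C (θ i))) *
    (Chebyshev.T ℝ ((n - 1 - (j : ℕ) : ℕ) : ℤ)).comp (C (2 / (d - c)) * X + C (1 - 2 * d / (d - c)))

theorem natDegree_kanielPoly_lt {n : ℕ} (θ : Fin n → ℝ) (j : Fin n) (c d : ℝ) :
    (kanielPoly θ j c d).natDegree < n := by
  have h1 : (∏ i ∈ Finset.univ.filter fun i : Fin n => (i : ℕ) < (j : ℕ),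
      (X - C (θ i))).natDegree ≤ (j : ℕ) := by
    refine (natDegree_prod_le _ _).trans ?_
    simp only [natDegree_X_sub_C, Finset.sum_const, Fin.card_filter_val_lt]
    simp
  have h2 : ((Chebyshev.T ℝ ((n - 1 - (j : ℕ) : ℕ) : ℤ)).comp
      (C (2 / (d - c)) * X + C (1 - 2 * d / (d - c)))).natDegree ≤ n - 1 - j := by
    refine natDegree_comp_le.trans ?_
    calc _ ≤ (n - 1 - (j : ℕ)) * 1 := Nat.mul_le_mul (by simp [Chebyshev.natDegree_T])
          natDegree_linear_le
      _ = _ := mul_one _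
  have h3 : (kanielPoly θ j c d).natDegree ≤ j + (n - 1 - j) :=
    natDegree_mul_le.trans (add_le_add h1 h2)
  have := j.2
  omega

theorem eval_kanielPoly {n : ℕ} (θ : Fin n → ℝ) (j : Fin n) (c d x : ℝ) :
    (kanielPoly θ j c d).eval x =
      (∏ i ∈ Finset.univ.filter fun i : Fin n => (i : ℕ) < (j : ℕ), (x - θ i)) *
        (Chebyshev.T ℝ ((n - 1 - (j : ℕ) : ℕ) : ℤ)).eval (1 + 2 * ((x - d) / (d - c))) := by
  rw [kanielPoly, eval_mul, eval_prod, eval_comp]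
  simp only [eval_sub, eval_X, eval_C, eval_add, eval_mul]
  congr 2
  ring

theorem sq_eval_kanielPoly_le {n : ℕ} {θ : Fin n → ℝ} {j : Fin n} {c d x : ℝ} (hcd : c < d)
    (hcx : c ≤ x) (hxd : x ≤ d) (hθ : ∀ i : Fin n, (i : ℕ) < (j : ℕ) → d ≤ θ i) :
    ((kanielPoly θ j c d).eval x) ^ 2 ≤
      (∏ i ∈ Finset.univ.filter fun i : Fin n => (i : ℕ) < (j : ℕ), (θ i - c)) ^ 2 := by
  have hd : 0 < d - c := sub_pos.mpr hcd
  rw [eval_kanielPoly, sq_le_sq, abs_mul]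
  have hT : |(Chebyshev.T ℝ ((n - 1 - (j : ℕ) : ℕ) : ℤ)).eval (1 + 2 * ((x - d) / (d - c)))| ≤ 1 := by
    apply Chebyshev.abs_eval_T_real_le_one
    have h1 : (x - d) / (d - c) ≤ 0 := div_nonpos_of_nonpos_of_nonneg (by linarith) hd.le
    have h2 : -1 ≤ (x - d) / (d - c) := by
      rw [le_div_iff₀ hd]
      linarith
    rw [abs_le]
    constructor <;> linarith
  refine (mul_le_of_le_one_right (abs_nonneg _) hT).trans ?_
  rw [Finset.abs_prod, Finset.abs_prod]
  refine Finset.prod_le_prod (fun i _ => abs_nonneg _) fun i hi => ?_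
  have := hθ i (Finset.mem_filter.mp hi).2
  rw [abs_of_nonpos (by linarith), abs_of_nonneg (by linarith)]
  linarith

/-- **Kaniel–Paige–Saad bound, exponential form.**  Under the hypotheses of the
Kaniel–Paige–Saad bound and assuming additionally `λ_j > λ_{j+1}`, setting
`μ_j = √((λ_j − λ_{j+1})/(λ_{j+1} − λ_N))` one has `γ_j(λ_j) = 1 + 2μ_j²` and
`0 ≤ λ_j − θ_j ≤ 4(λ_j − λ_N)(K_j tan∠_j)²·(1 + 2μ_j² + 2μ_j√(1+μ_j²))^{−2(n−j)}`
(with 1-based index `j+1` for the zero-based `j : Fin n`, so `n − j` is `n - j - 1`). -/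
theorem kaniel_paige_saad_exponential {N n : ℕ}
    (A : Matrix (Fin N) (Fin N) ℂ) (hA : A.IsHermitian)
    (lam : Fin N → ℝ) (hlam : Antitone lam)
    (z : Fin N → (Fin N → ℂ))
    (hz : ∀ i k, star (z i) ⬝ᵥ z k = if i = k then 1 else 0)
    (hAz : ∀ i, A.mulVec (z i) = (lam i : ℂ) • z i)
    (v : Fin N → ℂ) (hv : v ≠ 0) (hn : 1 ≤ n)
    (hK : Module.finrank ℂ (Krylov A v n) = n) (hnN : n ≤ N)
    (Q : Matrix (Fin N) (Fin n) ℂ) (hQ : Qᴴ * Q = 1)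
    (hQX : LinearMap.range Q.mulVecLin = Krylov A v n)
    (θ : Fin n → ℝ) (hθ : Antitone θ)
    (s : Fin n → (Fin n → ℂ))
    (hs : ∀ i k, star (s i) ⬝ᵥ s k = if i = k then 1 else 0)
    (hθs : ∀ i, (Qᴴ * A * Q).mulVec (s i) = (θ i : ℂ) • s i)
    (j : Fin n) (hjN : (j : ℕ) + 1 < N)
    (hzv : star (z (Fin.castLE hnN j)) ⬝ᵥ v ≠ 0)
    (hgap : lam ⟨(j : ℕ) + 1, hjN⟩ > lam ⟨N - 1, by omega⟩)
    (hθi : ∀ i : Fin n, (i : ℕ) < (j : ℕ) → θ i > lam (Fin.castLE hnN j))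
    (hgap' : lam (Fin.castLE hnN j) > lam ⟨(j : ℕ) + 1, hjN⟩)
    (μ : ℝ)
    (hμ : μ = Real.sqrt ((lam (Fin.castLE hnN j) - lam ⟨(j : ℕ) + 1, hjN⟩) /
      (lam ⟨(j : ℕ) + 1, hjN⟩ - lam ⟨N - 1, by omega⟩))) :
    1 + 2 * (lam (Fin.castLE hnN j) - lam ⟨(j : ℕ) + 1, hjN⟩) /
        (lam ⟨(j : ℕ) + 1, hjN⟩ - lam ⟨N - 1, by omega⟩) = 1 + 2 * μ ^ 2 ∧
    0 ≤ lam (Fin.castLE hnN j) - θ j ∧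
    lam (Fin.castLE hnN j) - θ j ≤
      4 * (lam (Fin.castLE hnN j) - lam ⟨N - 1, by omega⟩) *
        ((∏ i ∈ Finset.univ.filter fun i : Fin n => (i : ℕ) < (j : ℕ),
            (θ i - lam ⟨N - 1, by omega⟩) / (θ i - lam (Fin.castLE hnN j))) ^ 2 *
          ((∑ k ∈ Finset.univ.filter fun k : Fin N => (j : ℕ) < (k : ℕ),
              ‖star (z k) ⬝ᵥ v‖ ^ 2) / ‖star (z (Fin.castLE hnN j)) ⬝ᵥ v‖ ^ 2)) *
        (1 + 2 * μ ^ 2 + 2 * μ * Real.sqrt (1 + μ ^ 2)) ^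
          (-(2 * ((n : ℤ) - (j : ℕ) - 1))) := by
  have hd : 0 < lam ⟨(j : ℕ) + 1, hjN⟩ - lam ⟨N - 1, by omega⟩ := sub_pos.mpr hgap
  have hμ0 : 0 ≤ μ := hμ ▸ Real.sqrt_nonneg _
  have hμ2 : (lam (Fin.castLE hnN j) - lam ⟨(j : ℕ) + 1, hjN⟩) /
      (lam ⟨(j : ℕ) + 1, hjN⟩ - lam ⟨N - 1, by omega⟩) = μ ^ 2 := by
    rw [hμ, Real.sq_sqrt (div_nonneg (sub_nonneg.mpr hgap'.le) hd.le)]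
  have hle := ritz_le_eigenvalue hlam hz hAz hnN hQ hθ hs hθs j
  refine ⟨by rw [mul_div_assoc, hμ2], sub_nonneg.mpr hle, ?_⟩
  have hmin : ∀ k, lam ⟨N - 1, by omega⟩ ≤ lam k := fun k =>
    hlam (Fin.le_def.mpr (by have := k.2; simp only; omega))
  have hray := sum_eigenvalue_mul_eval_le hA hz hAz hQ hQX hθ hs hθs j
    (natDegree_kanielPoly_lt θ j (lam ⟨N - 1, by omega⟩) (lam ⟨(j : ℕ) + 1, hjN⟩))
    fun i hi => (Finset.dvd_prod_of_mem (fun i => X - C (θ i)) (by simpa using hi)).mul_right _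
  have hmain := gap_mul_le_of_sum_le (j := Fin.castLE hnN j) hlam (fun k => sq_nonneg _)
    (fun k => sq_nonneg _) hle hmin
    (fun k hk => sq_eval_kanielPoly_le hgap (hmin k) (hlam (Fin.le_def.mpr hk))
      fun i hi => (hgap'.trans (hθi i hi)).le) hray
  rw [eval_kanielPoly, hμ2] at hmain
  have hT := half_pow_le_eval_T μ (n - 1 - j)
  have hexp : (-(2 * ((n : ℤ) - (j : ℕ) - 1))) = -((2 * (n - 1 - j) : ℕ) : ℤ) := by
    have := j.2
    omega
  rw [hexp, _root_.zpow_neg, zpow_natCast, pow_mul', Finset.prod_div_distrib]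
  have hE : 0 < (1 + 2 * μ ^ 2 + 2 * μ * √(1 + μ ^ 2)) ^ (n - 1 - (j : ℕ)) := by positivity
  have hD : (∏ i ∈ Finset.univ.filter fun i : Fin n => (i : ℕ) < (j : ℕ),
        (lam (Fin.castLE hnN j) - θ i)) ^ 2 =
      (∏ i ∈ Finset.univ.filter fun i : Fin n => (i : ℕ) < (j : ℕ),
        (θ i - lam (Fin.castLE hnN j))) ^ 2 := by
    rw [← Finset.prod_pow, ← Finset.prod_pow]
    exact Finset.prod_congr rfl fun i _ => by ring
  have hD0 : 0 < ∏ i ∈ Finset.univ.filter fun i : Fin n => (i : ℕ) < (j : ℕ),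
      (θ i - lam (Fin.castLE hnN j)) :=
    Finset.prod_pos fun i hi => sub_pos.mpr (hθi i (Finset.mem_filter.mp hi).2)
  have ha : 0 < ‖star (z (Fin.castLE hnN j)) ⬝ᵥ v‖ := norm_pos_iff.mpr hzv
  rw [mul_pow, hD] at hmain
  generalize (1 + 2 * μ ^ 2 + 2 * μ * √(1 + μ ^ 2)) ^ (n - 1 - (j : ℕ)) = E at *
  generalize (Chebyshev.T ℝ _).eval _ = T at *
  generalize ∏ i ∈ Finset.univ.filter fun i : Fin n => (i : ℕ) < (j : ℕ),
      (θ i - lam (Fin.castLE hnN j)) = D at *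
  generalize ‖star (z (Fin.castLE hnN j)) ⬝ᵥ v‖ = a at *
  have hTE : (E / 2) ^ 2 ≤ T ^ 2 := pow_le_pow_left₀ (by positivity) hT 2
  have hlow : (lam (Fin.castLE hnN j) - θ j) * (D ^ 2 * (E / 2) ^ 2 * a ^ 2) ≤
      (lam (Fin.castLE hnN j) - θ j) * (D ^ 2 * T ^ 2 * a ^ 2) :=
    mul_le_mul_of_nonneg_left (by gcongr) (sub_nonneg.mpr hle)
  have hfin := (le_div_iff₀ (by positivity)).mpr (hlow.trans hmain)
  refine hfin.trans_eq ?_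
  simp only [Fin.val_castLE]
  field_simp
  ring
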